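/- Let u : ℝ³ → ℝ³ and p : ℝ³ → ℝ be C^∞ and solve the stationary incompressible Navier–Stokes equations −Δu + (u·∇)u + ∇p = 0, div u = 0 on ℝ³. If ∫_{ℝ³} |∇u|² dx < +∞, ∫_{ℝ³} |u|⁴ dx < +∞ and ∫_{ℝ³} |p|² dx < +∞, then u ≡ 0. -/

import Mathlib

open MeasureTheory Filter Metric Real

noncomputable section

/-- Three-dimensional Euclidean space. -/
abbrev E3 : Type := EuclideanSpace ℝ (Fin 3)

/-- Partial derivative `∂_j f` of a scalar field. -/
def pd (j : Fin 3) (f : E3 → ℝ) (x : E3) : ℝ :=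
  fderiv ℝ f x (EuclideanSpace.single j 1)

/-- Laplacian of a scalar field. -/
def lap (f : E3 → ℝ) (x : E3) : ℝ := ∑ j, pd j (pd j f) x

/-- The annulus `C(R/2, R)`. -/
def ann (R : ℝ) : Set E3 := {x : E3 | R / 2 < ‖x‖ ∧ ‖x‖ < R}

/-- Euclidean length `|u(x)|` of a vector field. -/
def vecNorm (u : E3 → Fin 3 → ℝ) (x : E3) : ℝ := Real.sqrt (∑ i, (u x i) ^ 2)

/-- The stationary incompressible Navier–Stokes equations:
`−Δu + (u·∇)u + ∇p = 0`, `div u = 0`. -/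
def StatNS (u : E3 → Fin 3 → ℝ) (P : E3 → ℝ) : Prop :=
  (∀ x : E3, ∀ i : Fin 3,
    -(lap (fun y => u y i) x) + (∑ j, u x j * pd j (fun y => u y i) x)
      + pd i P x = 0) ∧
  (∀ x : E3, ∑ j, pd j (fun y => u y j) x = 0)

/-- `|∇u|² = Σ_{i,j} (∂_j u_i)²`. -/
def gradSq (u : E3 → Fin 3 → ℝ) (x : E3) : ℝ :=
  ∑ i, ∑ j, (pd j (fun y => u y i) x) ^ 2

/-- The flux whose divergence is `|∇u|²` for a solution `(u, P)`. -/
def energyFlux (u : E3 → Fin 3 → ℝ) (P : E3 → ℝ) (j : Fin 3) (x : E3) : ℝ :=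
  (∑ i, u x i * pd j (fun y => u y i) x) - (1 / 2 * ∑ i, (u x i) ^ 2 + P x) * u x j

theorem contDiff_pd {f : E3 → ℝ} (hf : ContDiff ℝ (⊤ : ℕ∞) f) (j : Fin 3) :
    ContDiff ℝ (⊤ : ℕ∞) (pd j f) :=
  (hf.fderiv_right (m := (⊤ : ℕ∞)) (by simp)).clm_apply contDiff_const

theorem pd_mul {f g : E3 → ℝ} (hf : Differentiable ℝ f) (hg : Differentiable ℝ g)
    (j : Fin 3) (x : E3) :
    pd j (fun y => f y * g y) x = f x * pd j g x + g x * pd j f x := by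
  simp [pd, fderiv_fun_mul (hf x) (hg x)]

theorem pd_add {f g : E3 → ℝ} (hf : Differentiable ℝ f) (hg : Differentiable ℝ g)
    (j : Fin 3) (x : E3) :
    pd j (fun y => f y + g y) x = pd j f x + pd j g x := by
  simp [pd, fderiv_fun_add (hf x) (hg x)]

theorem pd_sub {f g : E3 → ℝ} (hf : Differentiable ℝ f) (hg : Differentiable ℝ g)
    (j : Fin 3) (x : E3) :
    pd j (fun y => f y - g y) x = pd j f x - pd j g x := by
  simp [pd, fderiv_fun_sub (hf x) (hg x)]

theorem pd_sum {f : Fin 3 → E3 → ℝ} (hf : ∀ i, Differentiable ℝ (f i)) (j : Fin 3) (x : E3) :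
    pd j (fun y => ∑ i, f i y) x = ∑ i, pd j (f i) x := by
  simp [pd, fderiv_fun_sum fun i _ => hf i x]

theorem pd_sq {f : E3 → ℝ} (hf : Differentiable ℝ f) (j : Fin 3) (x : E3) :
    pd j (fun y => f y ^ 2) x = 2 * (f x * pd j f x) := by
  simp only [pow_two]
  rw [pd_mul hf hf]
  ring

theorem pd_const_mul {f : E3 → ℝ} (hf : Differentiable ℝ f) (c : ℝ) (j : Fin 3) (x : E3) :
    pd j (fun y => c * f y) x = c * pd j f x := by
  simp [pd, fderiv_const_mul (hf x)]

section

variable {u : E3 → Fin 3 → ℝ} {P : E3 → ℝ}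

theorem contDiff_energyFlux (hu : ContDiff ℝ (⊤ : ℕ∞) u) (hP : ContDiff ℝ (⊤ : ℕ∞) P)
    (j : Fin 3) : ContDiff ℝ (⊤ : ℕ∞) (energyFlux u P j) := by
  have hui : ∀ i, ContDiff ℝ (⊤ : ℕ∞) fun y => u y i := contDiff_pi.1 hu
  have hdu : ∀ i, ContDiff ℝ (⊤ : ℕ∞) (pd j fun y => u y i) := fun i => contDiff_pd (hui i) j
  unfold energyFlux
  exact (ContDiff.sum fun i _ => (hui i).mul (hdu i)).sub
    (((contDiff_const.mul (ContDiff.sum fun i _ => (hui i).pow 2)).add hP).mul (hui j))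

theorem continuous_gradSq (hu : ContDiff ℝ (⊤ : ℕ∞) u) : Continuous (gradSq u) :=
  continuous_finsetSum _ fun i _ => continuous_finsetSum _ fun j _ =>
    (contDiff_pd (contDiff_pi.1 hu i) j).continuous.pow 2

theorem gradSq_nonneg (x : E3) : 0 ≤ gradSq u x :=
  Finset.sum_nonneg fun _ _ => Finset.sum_nonneg fun _ _ => sq_nonneg _

theorem sum_pd_energyFlux (hu : ContDiff ℝ (⊤ : ℕ∞) u) (hP : ContDiff ℝ (⊤ : ℕ∞) P)
    (hsol : StatNS u P) (x : E3) : ∑ j, pd j (energyFlux u P j) x = gradSq u x := by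
  have hui : ∀ i, Differentiable ℝ fun y => u y i :=
    fun i => (contDiff_pi.1 hu i).differentiable (by simp)
  have hdu : ∀ i j, Differentiable ℝ (pd j fun y => u y i) :=
    fun i j => (contDiff_pd (contDiff_pi.1 hu i) j).differentiable (by simp)
  have hPd : Differentiable ℝ P := hP.differentiable (by simp)
  have hq : Differentiable ℝ fun y => ∑ i, (u y i) ^ 2 :=
    Differentiable.fun_sum fun i _ => (hui i).pow 2
  have key : ∀ j, pd j (energyFlux u P j) x =
      (∑ i, (u x i * pd j (pd j fun y => u y i) x
        + pd j (fun y => u y i) x * pd j (fun y => u y i) x))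
      - ((1 / 2 * ∑ i, (u x i) ^ 2 + P x) * pd j (fun y => u y j) x
        + u x j * (1 / 2 * (∑ i, 2 * (u x i * pd j (fun y => u y i) x)) + pd j P x)) := by
    intro j
    have h1 : ∀ i, Differentiable ℝ fun y => u y i * pd j (fun z => u z i) y :=
      fun i => (hui i).mul (hdu i j)
    have h2 : Differentiable ℝ fun y => 1 / 2 * ∑ i, (u y i) ^ 2 := hq.const_mul _
    have h3 : Differentiable ℝ fun y => 1 / 2 * ∑ i, (u y i) ^ 2 + P y := h2.add hPd
    have h4 : Differentiable ℝ fun y => ∑ i, u y i * pd j (fun z => u z i) y :=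
      Differentiable.fun_sum fun i _ => h1 i
    have h5 : Differentiable ℝ fun y => (1 / 2 * ∑ i, (u y i) ^ 2 + P y) * u y j :=
      h3.mul (hui j)
    have h6 : ∀ i, Differentiable ℝ fun y => (u y i) ^ 2 := fun i => (hui i).pow 2
    unfold energyFlux
    rw [pd_sub h4 h5, pd_sum h1, pd_mul h3 (hui j), pd_add h2 hPd, pd_const_mul hq, pd_sum h6]
    simp only [pd_mul (hui _) (hdu _ j), pd_sq (hui _)]
  simp only [key]
  have h0 := hsol.1 x 0
  have h1 := hsol.1 x 1
  have h2 := hsol.1 x 2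
  have hd := hsol.2 x
  simp only [lap, gradSq, Fin.sum_univ_three] at *
  linear_combination (-u x 0) * h0 - u x 1 * h1 - u x 2 * h2
    - (1 / 2 * (u x 0 ^ 2 + u x 1 ^ 2 + u x 2 ^ 2) + P x) * hd

theorem integral_mul_gradSq (hu : ContDiff ℝ (⊤ : ℕ∞) u) (hP : ContDiff ℝ (⊤ : ℕ∞) P)
    (hsol : StatNS u P) {φ : E3 → ℝ} (hφ : ContDiff ℝ (⊤ : ℕ∞) φ) (hc : HasCompactSupport φ) :
    ∫ x, φ x * gradSq u x = -∑ j, ∫ x, pd j φ x * energyFlux u P j x := by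
  have hF := contDiff_energyFlux hu hP
  have hi : ∀ j, Integrable fun x => φ x * pd j (energyFlux u P j) x := fun j =>
    (hφ.continuous.mul (contDiff_pd (hF j) j).continuous).integrable_of_hasCompactSupport
      hc.mul_right
  calc ∫ x, φ x * gradSq u x = ∫ x, ∑ j, φ x * pd j (energyFlux u P j) x := by
        simp only [← Finset.mul_sum, sum_pd_energyFlux hu hP hsol]
    _ = ∑ j, ∫ x, φ x * pd j (energyFlux u P j) x := integral_finsetSum _ fun j _ => hi j
    _ = -∑ j, ∫ x, pd j φ x * energyFlux u P j x := by
        rw [← Finset.sum_neg_distrib]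
        refine Finset.sum_congr rfl fun j _ => ?_
        refine integral_mul_fderiv_eq_neg_fderiv_mul_of_integrable ?_ (hi j) ?_
          (fun x _ => hφ.differentiable (by simp) x) (fun x _ => (hF j).differentiable (by simp) x)
        · exact ((contDiff_pd hφ j).continuous.mul
            (hF j).continuous).integrable_of_hasCompactSupport (hc.fderiv_apply ℝ _).mul_right
        · exact (hφ.continuous.mul (hF j).continuous).integrable_of_hasCompactSupport hc.mul_right

theorem abs_energyFlux_le {t : ℝ} (ht : 0 < t) (j : Fin 3) (x : E3) :
    |energyFlux u P j x| ≤
      6 * (t ^ 3 * (gradSq u x + (∑ i, (u x i) ^ 2) ^ 2 + P x ^ 2) + (t ^ 9)⁻¹) := by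
  set q := ∑ i, (u x i) ^ 2 with hq
  have hq0 : 0 ≤ q := Finset.sum_nonneg fun _ _ => sq_nonneg _
  have hui : ∀ i, (u x i) ^ 2 ≤ q := fun i =>
    Finset.single_le_sum (f := fun i => (u x i) ^ 2) (fun _ _ => sq_nonneg _) (Finset.mem_univ i)
  have young : ∀ a b : ℝ, b ^ 2 ≤ q → |a * b| ≤ (t ^ 3 * a ^ 2 + (t ^ 3)⁻¹ * q) / 2 := by
    intro a b hb
    have h1 : (t ^ 3)⁻¹ * b ^ 2 ≤ (t ^ 3)⁻¹ * q := by gcongr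
    have h2 : (t ^ 3 * a ^ 2 + (t ^ 3)⁻¹ * b ^ 2) / 2 - |a| * |b| =
        (t ^ 3)⁻¹ * (t ^ 3 * |a| - |b|) ^ 2 / 2 := by
      rw [← sq_abs a, ← sq_abs b]
      field_simp
      ring
    have h3 : 0 ≤ (t ^ 3)⁻¹ * (t ^ 3 * |a| - |b|) ^ 2 / 2 := by positivity
    rw [abs_mul]
    linarith
  have hq2 : (t ^ 3)⁻¹ * q ≤ t ^ 3 * q ^ 2 + (t ^ 9)⁻¹ := by
    have h2 : (t ^ 3 * q ^ 2 + (t ^ 9)⁻¹) - (t ^ 3)⁻¹ * q =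
        (t ^ 9)⁻¹ * ((t ^ 6 * q - 1 / 2) ^ 2 + 3 / 4) := by
      field_simp
      ring
    have h3 : 0 ≤ (t ^ 9)⁻¹ * ((t ^ 6 * q - 1 / 2) ^ 2 + 3 / 4) := by positivity
    linarith
  have hg : ∑ i, (pd j (fun y => u y i) x) ^ 2 ≤ gradSq u x :=
    Finset.sum_le_sum fun i _ => Finset.single_le_sum
      (f := fun j => (pd j (fun y => u y i) x) ^ 2) (fun _ _ => sq_nonneg _) (Finset.mem_univ j)
  have h1 := abs_le.1 (young (pd j (fun y => u y 0) x) (u x 0) (hui 0))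
  have h2 := abs_le.1 (young (pd j (fun y => u y 1) x) (u x 1) (hui 1))
  have h3 := abs_le.1 (young (pd j (fun y => u y 2) x) (u x 2) (hui 2))
  have h4 := abs_le.1 (young q (u x j) (hui j))
  have h5 := abs_le.1 (young (P x) (u x j) (hui j))
  have ht3 : 0 < t ^ 3 := by positivity
  have ht9 : 0 < (t ^ 9)⁻¹ := by positivity
  have hg' := mul_le_mul_of_nonneg_left hg ht3.le
  have hg0 := mul_nonneg ht3.le (gradSq_nonneg (u := u) x)
  have hP0 := mul_nonneg ht3.le (sq_nonneg (P x))
  have hqq0 := mul_nonneg ht3.le (sq_nonneg q)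
  simp only [energyFlux, ← hq]
  rw [Fin.sum_univ_three] at hg' ⊢
  rw [abs_le]
  constructor <;> nlinarith

end

/-- Rescaled cutoffs equal to `1` on the ball of radius `R`, with gradient of size `1 / R`
supported in the ball of radius `2 * R`. -/
theorem exists_cutoff : ∃ C : ℝ, 0 ≤ C ∧ ∀ R : ℝ, 0 < R → ∃ φ : E3 → ℝ,
    ContDiff ℝ (⊤ : ℕ∞) φ ∧ HasCompactSupport φ ∧ (∀ x, 0 ≤ φ x) ∧
      (∀ x, ‖x‖ ≤ R → φ x = 1) ∧
      (∀ j x, ‖x‖ ≤ R * 2 → |pd j φ x| ≤ C / R) ∧ ∀ j x, R * 2 < ‖x‖ → pd j φ x = 0 := by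
  let η : ContDiffBump (0 : E3) := ⟨1, 2, one_pos, one_lt_two⟩
  obtain ⟨C, hC⟩ := (η.contDiff (n := (⊤ : ℕ∞)) |>.continuous_fderiv
    (by simp)).bounded_above_of_compact_support (η.hasCompactSupport.fderiv ℝ)
  refine ⟨C, (norm_nonneg _).trans (hC 0), fun R hR =>
    ⟨fun x => η (R⁻¹ • x), ?_, ?_, ?_, ?_, ?_, ?_⟩⟩
  · exact η.contDiff.comp (contDiff_const_smul _)
  · exact η.hasCompactSupport.comp_smul (inv_ne_zero hR.ne')
  · exact fun x => η.nonneg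
  · intro x hx
    refine η.one_of_mem_closedBall ?_
    simpa [η, norm_smul, abs_of_pos hR, inv_mul_le_iff₀ hR] using hx
  · intro j x _
    rw [pd, fderiv_comp_smul]
    calc |(R⁻¹ • fderiv ℝ η (R⁻¹ • x)) (EuclideanSpace.single j 1)|
        ≤ ‖R⁻¹ • fderiv ℝ η (R⁻¹ • x)‖ * ‖EuclideanSpace.single j (1 : ℝ)‖ :=
          (R⁻¹ • fderiv ℝ η (R⁻¹ • x)).le_opNorm _
      _ = R⁻¹ * ‖fderiv ℝ η (R⁻¹ • x)‖ := by simp [norm_smul, abs_of_pos hR]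
      _ ≤ C / R := by
          rw [div_eq_inv_mul]
          gcongr
          exact hC _
  · intro j x hx
    rw [pd, fderiv_comp_smul]
    have : fderiv ℝ η (R⁻¹ • x) = 0 := by
      refine image_eq_zero_of_notMem_tsupport fun h => ?_
      have h' := tsupport_fderiv_subset ℝ h
      rw [η.tsupport_eq, mem_closedBall_zero_iff, norm_smul, norm_inv, Real.norm_of_nonneg hR.le,
        inv_mul_le_iff₀ hR] at h'
      exact absurd h' (not_le.2 hx)
    simp [this]

theorem volume_real_closedBall_mul {R : ℝ} (hR : 0 ≤ R) :
    volume.real (closedBall (0 : E3) (R * 2)) = R ^ 3 * volume.real (closedBall (0 : E3) 2) := by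
  rw [measureReal_def, Measure.addHaar_closedBall_mul volume (0 : E3) hR zero_le_two]
  simp [measureReal_def, ENNReal.toReal_mul, hR]

theorem setIntegral_gradSq_le {u : E3 → Fin 3 → ℝ} {P : E3 → ℝ}
    (hu : ContDiff ℝ (⊤ : ℕ∞) u) (hP : ContDiff ℝ (⊤ : ℕ∞) P) (hsol : StatNS u P)
    (hgrad : Integrable (fun x : E3 => gradSq u x))
    (hu4 : Integrable (fun x : E3 => (∑ i, (u x i) ^ 2) ^ 2))
    (hP2 : Integrable (fun x : E3 => (P x) ^ 2)) :
    ∃ K : ℝ, ∀ t : ℝ, 0 < t → ∫ x in closedBall (0 : E3) (t ^ 4), gradSq u x ≤ K / t := by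
  obtain ⟨C, hC, hcut⟩ := exists_cutoff
  set H : E3 → ℝ := fun x => gradSq u x + (∑ i, (u x i) ^ 2) ^ 2 + P x ^ 2 with hH
  have hHi : Integrable H := (hgrad.add hu4).add hP2
  have hH0 : ∀ x, 0 ≤ H x := fun x => by have := gradSq_nonneg (u := u) x; positivity
  refine ⟨3 * (6 * C * (∫ x, H x) + 6 * C * volume.real (closedBall (0 : E3) 2)), fun t ht => ?_⟩
  have hR : 0 < t ^ 4 := by positivity
  obtain ⟨φ, hφ, hc, hφ0, hφ1, hbd, hz⟩ := hcut (t ^ 4) hR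
  have hφg : Integrable fun x => φ x * gradSq u x :=
    (hφ.continuous.mul (continuous_gradSq hu)).integrable_of_hasCompactSupport hc.mul_right
  have hfin : volume (closedBall (0 : E3) (t ^ 4 * 2)) ≠ ⊤ := measure_closedBall_lt_top.ne
  have hflux : ∀ j, |∫ x, pd j φ x * energyFlux u P j x| ≤
      (6 * C * (∫ x, H x) + 6 * C * volume.real (closedBall (0 : E3) 2)) / t := by
    intro j
    have hind : Integrable ((closedBall (0 : E3) (t ^ 4 * 2)).indicator
        fun _ => 6 * C * (t ^ 13)⁻¹) :=
      (integrableOn_const hfin).integrable_indicator measurableSet_closedBall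
    calc |∫ x, pd j φ x * energyFlux u P j x|
        ≤ ∫ x, (6 * C / t * H x + (closedBall (0 : E3) (t ^ 4 * 2)).indicator
            (fun _ => 6 * C * (t ^ 13)⁻¹) x) := by
          rw [← Real.norm_eq_abs]
          refine norm_integral_le_of_norm_le ((hHi.const_mul (6 * C / t)).add hind)
            (ae_of_all _ fun x => ?_)
          by_cases hx : ‖x‖ ≤ t ^ 4 * 2
          · rw [Set.indicator_of_mem (mem_closedBall_zero_iff.2 hx), norm_mul]
            calc |pd j φ x| * |energyFlux u P j x|
                ≤ C / t ^ 4 * (6 * (t ^ 3 * H x + (t ^ 9)⁻¹)) := by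
                  gcongr
                  · exact hbd j x hx
                  · exact abs_energyFlux_le ht j x
              _ = 6 * C / t * H x + 6 * C * (t ^ 13)⁻¹ := by
                  field_simp
          · rw [Set.indicator_of_notMem (by simpa using hx), hz j x (not_le.1 hx)]
            have := hH0 x
            simp only [zero_mul, norm_zero, add_zero]
            positivity
      _ = 6 * C / t * (∫ x, H x)
          + (t ^ 4) ^ 3 * volume.real (closedBall (0 : E3) 2) * (6 * C * (t ^ 13)⁻¹) := by
          rw [integral_add (hHi.const_mul _) hind, integral_const_mul,
            integral_indicator measurableSet_closedBall, setIntegral_const,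
            volume_real_closedBall_mul hR.le, smul_eq_mul]
      _ = _ := by
          field_simp
  calc ∫ x in closedBall (0 : E3) (t ^ 4), gradSq u x
      = ∫ x in closedBall (0 : E3) (t ^ 4), φ x * gradSq u x :=
        setIntegral_congr_fun measurableSet_closedBall fun x hx => by
          simp [hφ1 x (mem_closedBall_zero_iff.1 hx)]
    _ ≤ ∫ x, φ x * gradSq u x :=
        setIntegral_le_integral hφg
          (ae_of_all _ fun x => mul_nonneg (hφ0 x) (gradSq_nonneg x))
    _ = -∑ j, ∫ x, pd j φ x * energyFlux u P j x := integral_mul_gradSq hu hP hsol hφ hc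
    _ ≤ ∑ j, |∫ x, pd j φ x * energyFlux u P j x| := by
        rw [← Finset.sum_neg_distrib]
        exact Finset.sum_le_sum fun j _ => neg_le_abs _
    _ ≤ ∑ _j : Fin 3,
          (6 * C * (∫ x, H x) + 6 * C * volume.real (closedBall (0 : E3) 2)) / t :=
        Finset.sum_le_sum fun j _ => hflux j
    _ = _ := by
        simp only [Finset.sum_const, Finset.card_univ, Fintype.card_fin, nsmul_eq_mul]
        push_cast
        ring

theorem fderiv_eq_zero_of_pd_eq_zero {f : E3 → ℝ} {x : E3} (h : ∀ j, pd j f x = 0) :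
    fderiv ℝ f x = 0 := by
  refine ContinuousLinearMap.coe_injective
    ((EuclideanSpace.basisFun (Fin 3) ℝ).toBasis.ext fun j => ?_)
  simpa [pd] using h j

theorem NS_finite_energy_L4_liouville
    (u : E3 → Fin 3 → ℝ) (P : E3 → ℝ)
    (hu : ContDiff ℝ (⊤ : ℕ∞) u) (hP : ContDiff ℝ (⊤ : ℕ∞) P)
    (hsol : StatNS u P)
    (hgrad : Integrable (fun x : E3 => gradSq u x))
    (hu4 : Integrable (fun x : E3 => (∑ i, (u x i) ^ 2) ^ 2))
    (hP2 : Integrable (fun x : E3 => (P x) ^ 2)) :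
    ∀ x : E3, ∀ i : Fin 3, u x i = 0 := by
  obtain ⟨K, hK⟩ := setIntegral_gradSq_le hu hP hsol hgrad hu4 hP2
  have hlim : Tendsto (fun t : ℝ => ∫ x in closedBall (0 : E3) (t ^ 4), gradSq u x) atTop
      (nhds (∫ x, gradSq u x)) :=
    (aecover_closedBall (tendsto_pow_atTop four_ne_zero)).integral_tendsto_of_countably_generated
      hgrad
  have hint : ∫ x, gradSq u x = 0 :=
    le_antisymm (le_of_tendsto_of_tendsto hlim (tendsto_const_nhds.div_atTop tendsto_id)
      ((eventually_gt_atTop 0).mono hK)) (integral_nonneg gradSq_nonneg)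
  have hg0 : gradSq u = 0 :=
    ((continuous_gradSq hu).ae_eq_iff_eq volume continuous_zero).1
      ((integral_eq_zero_iff_of_nonneg gradSq_nonneg hgrad).1 hint)
  have hpd : ∀ i j x, pd j (fun y => u y i) x = 0 := by
    intro i j x
    have h := congrFun hg0 x
    rw [gradSq, Pi.zero_apply, Finset.sum_eq_zero_iff_of_nonneg
      fun _ _ => Finset.sum_nonneg fun _ _ => sq_nonneg _] at h
    have h' := h i (Finset.mem_univ i)
    rw [Finset.sum_eq_zero_iff_of_nonneg fun _ _ => sq_nonneg _] at h'
    exact pow_eq_zero_iff two_ne_zero |>.1 (h' j (Finset.mem_univ j))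
  have hconst : ∀ x y i, u x i = u y i := fun x y i =>
    is_const_of_fderiv_eq_zero (𝕜 := ℝ) ((contDiff_pi.1 hu i).differentiable (by simp))
      (fun z => fderiv_eq_zero_of_pd_eq_zero fun j => hpd i j z) x y
  intro x i
  have hcst : (fun y : E3 => (∑ i, (u y i) ^ 2) ^ 2) = fun _ => (∑ i, (u x i) ^ 2) ^ 2 :=
    funext fun y => by simp only [hconst y x]
  rw [hcst, integrable_const_iff] at hu4
  rcases hu4 with h | h
  · have h' := pow_eq_zero_iff two_ne_zero |>.1 h
    rw [Finset.sum_eq_zero_iff_of_nonneg fun _ _ => sq_nonneg _] at h'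
    exact pow_eq_zero_iff two_ne_zero |>.1 (h' i (Finset.mem_univ i))
  · exact absurd (measure_lt_top (volume : Measure E3) Set.univ)
      (by simp [measure_univ_of_isAddLeftInvariant])
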